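/- 27 + (η(i√3/9)/η(i√3/3))^{12} = 6 − 6·2^{1/3} + 18·2^{2/3}; that is, the modular function t₃(τ) = 27 + (η(τ)/η(3τ))^{12} takes the value 6 − 6·2^{1/3} + 18·2^{2/3} at τ₀ = √−3/9. -/

import Mathlib

/-- The Dedekind eta function `η(τ) = e^{πiτ/12} ∏_{n≥1} (1 − e^{2πinτ})` (for `Im τ > 0`). -/
noncomputable def eta (τ : ℂ) : ℂ :=
  Complex.exp (Real.pi * Complex.I * τ / 12) *
    ∏' n : ℕ, (1 - Complex.exp (2 * Real.pi * Complex.I * ((n : ℂ) + 1) * τ))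


open Filter Topology

lemma sum_aux (f g : ℕ → ℂ) (a b : ℂ) (h0 : g 0 = (a + b) * f 0 - b * f 1)
    (h : ∀ r, g (r+1) = a * f (r+1) - b * (f r + f (r+2))) (M : ℕ) :
    ∑ r ∈ Finset.range (M+1), (2*(r:ℂ)+1) * g r = (a - 2*b) * ∑ r ∈ Finset.range (M+1), (2*(r:ℂ)+1) * f r
      + b * ((2*M+3) * f M - (2*M+1) * f (M+1)) := by
  induction M with
  | zero => simp [h0]; ring
  | succ M ih =>
    rw [Finset.sum_range_succ, ih, Finset.sum_range_succ _ (M+1), h]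
    push_cast
    ring

noncomputable def Q (q : ℂ) (n : ℕ) : ℂ := ∏ i ∈ Finset.range n, (1 - q^(i+1))

lemma Q_succ (q : ℂ) (n : ℕ) : Q q (n+1) = Q q n * (1 - q^(n+1)) := Finset.prod_range_succ _ _

noncomputable def ee (q : ℂ) (n r : ℕ) : ℂ :=
  if r ≤ n then (-1)^r * q^(r*(r+1)/2) * (Q q (2*n+1) / (Q q (n-r) * Q q (n+1+r))) else 0

lemma tri_succ (r : ℕ) : (r+1)*(r+1+1)/2 = r*(r+1)/2 + (r+1) := by
  rw [show (r+1)*(r+1+1) = r*(r+1) + (r+1)*2 by ring]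
  omega

lemma one_sub_ne {q : ℂ} (hq : ‖q‖ < 1) (n : ℕ) : 1 - q^(n+1) ≠ 0 := by
  intro h
  have h1 : q^(n+1) = 1 := (sub_eq_zero.mp h).symm
  have h2 : ‖q‖^(n+1) = 1 := by rw [← norm_pow, h1, norm_one]
  have : ‖q‖^(n+1) < 1 := pow_lt_one₀ (norm_nonneg q) hq (Nat.succ_ne_zero n)
  linarith

lemma Q_ne {q : ℂ} (hq : ‖q‖ < 1) (n : ℕ) : Q q n ≠ 0 :=
  Finset.prod_ne_zero_iff.mpr fun i _ => one_sub_ne hq i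

lemma ee_zero {q : ℂ} (hq : ‖q‖ < 1) (n : ℕ) : ee q (n+1) 0 =
   (1 + q^(2*n+2) + q^(n+1)) * ee q n 0 - q^(n+1) * ee q n 1 := by
  rcases n with _ | m
  · simp [ee, Q, Finset.prod_range_succ]
    have h1 := one_sub_ne hq 0
    have h2 := one_sub_ne hq 1
    norm_num at h1 h2
    field_simp
    ring
  · simp only [ee]
    rw [if_pos (by omega), if_pos (by omega), if_pos (by omega)]
    simp only [show 2*(m+1+1)+1 = 2*m+5 by ring, show 2*(m+1)+1=2*m+3 by ring,
      show m+1+1-0 = m+2 by omega, show m+1-0=m+1 by omega, show m+1-1 = m by omega, Q_succ, add_zero, show m+1+1+1 = m+3 by ring]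
    have := Q_ne hq m
    have := Q_ne hq (2*m)
    have := one_sub_ne hq m
    have := one_sub_ne hq (m+1)
    have := one_sub_ne hq (m+2)
    field_simp
    norm_num
    ring

lemma ee_succ {q : ℂ} (hq : ‖q‖ < 1) (n r : ℕ) : ee q (n+1) (r+1) =
   (1 + q^(2*n+2)) * ee q n (r+1) - q^(n+1) * (ee q n r + ee q n (r+2)) := by
  by_cases h1 : r + 2 ≤ n
  · obtain ⟨m, rfl⟩ := Nat.exists_eq_add_of_le h1
    simp only [ee]
    rw [if_pos (by omega), if_pos (by omega), if_pos (by omega), if_pos (by omega)]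
    rw [show 2*(r+2+m+1)+1 = 2*(r+2+m)+1+1+1 by ring, show r+2+m+1-(r+1) = m+1+1 by omega, 
      show r+2+m-(r+1) = m+1 by omega, show r+2+m-r = m+1+1 by omega, show r+2+m-(r+2) = m by omega,
      show r+2+m+1+1+(r+1) = 2*r+m+3+1+1 by ring, show r+2+m+1+(r+1) = 2*r+m+3+1 by ring,
      show r+2+m+1+r = 2*r+m+3 by ring, show r+2+m+1+(r+2) = 2*r+m+3+1+1 by ring,
      show r+2=r+1+1 by ring, tri_succ (r+1), tri_succ r]
    generalize r*(r+1)/2 = t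
    rw [Q_succ q (2*(r+1+1+m)+1+1), Q_succ q (2*(r+1+1+m)+1), Q_succ q (m+1), Q_succ q m, Q_succ q (2*r+m+3+1), Q_succ q (2*r+m+3)]
    have := Q_ne hq m
    have := Q_ne hq (2*(r+1+1+m)+1)
    have := Q_ne hq (2*r+m+3)
    have := one_sub_ne hq m
    have := one_sub_ne hq (m+1)
    have := one_sub_ne hq (2*r+m+3)
    have := one_sub_ne hq (2*r+m+3+1)
    field_simp
    ring
  · by_cases h2 : r + 1 ≤ n
    · obtain rfl : n = r + 1 := by omega
      simp only [ee]
      rw [if_pos (by omega), if_pos (by omega), if_pos (by omega), if_neg (by omega)]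
      rw [show 2*(r+1+1)+1 = 2*r+3+1+1 by ring, show r+1+1-(r+1) = 0+1 by omega,
        show r+1-(r+1) = 0 by omega, show r+1-r = 0+1 by omega, show 2*(r+1)+1=2*r+3 by ring,
        show r+1+1+1+(r+1) = 2*r+2+1+1 by ring, show r+1+1+(r+1) = 2*r+2+1 by ring,
        show r+1+1+r = 2*r+2 by ring, tri_succ]
      generalize r*(r+1)/2 = t
      rw [show 2*r+3 = 2*r+2+1 by ring, Q_succ q (2*r+2+1+1), Q_succ q (2*r+2+1), Q_succ q (2*r+2), Q_succ q 0]
      have := Q_ne hq 0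
      have := Q_ne hq (2*r+2)
      have := one_sub_ne hq 0
      have := one_sub_ne hq (2*r+2)
      have := one_sub_ne hq (2*r+2+1)
      have : Q q 0 = 1 := by simp [Q]
      rw [this]
      field_simp
      ring
    · by_cases h3 : r ≤ n
      · obtain rfl : n = r := by omega
        simp only [ee]
        rw [if_pos (by omega), if_neg (by omega), if_pos (by omega), if_neg (by omega)]
        rw [tri_succ, show n+1+1+(n+1) = 2*(n+1)+1 by ring, show n+1-(n+1) = 0 by omega, show n - n = 0 by omega, show n+1+n=2*n+1 by ring]
        have := Q_ne hq (2*n+1)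
        have := Q_ne hq (2*(n+1)+1)
        have : Q q 0 = 1 := by simp [Q]
        rw [this]
        field_simp
        ring
      · simp only [ee]
        rw [if_neg (by omega), if_neg (by omega), if_neg (by omega), if_neg (by omega)]
        ring

lemma finJac {q : ℂ} (hq : ‖q‖ < 1) (n : ℕ) :
    ∑ r ∈ Finset.range (n+1), (2*(r:ℂ)+1) * ee q n r = Q q n ^ 2 := by
  induction n with
  | zero => 
    have := one_sub_ne hq 0
    norm_num at this
    simp [ee, Q, this]
  | succ n ih =>
    rw [sum_aux (ee q n) (ee q (n+1)) (1+q^(2*n+2)) (q^(n+1)) (ee_zero hq n) (ee_succ hq n) (n+1),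
      Finset.sum_range_succ, ih, Q_succ]
    have h1 : ee q n (n+1) = 0 := by simp [ee]
    have h2 : ee q n (n+1+1) = 0 := by simp [ee]
    rw [h1, h2]
    ring

noncomputable def PP (q : ℂ) : ℂ := ∏' n : ℕ, (1 - q^(n+1))

lemma Q_tendsto {q : ℂ} (hq : ‖q‖ < 1) : Tendsto (Q q) atTop (𝓝 (PP q)) :=
  (ModularForm.multipliable_one_sub_pow hq).tendsto_prod_tprod_nat

lemma PP_ne {q : ℂ} (hq : ‖q‖ < 1) : PP q ≠ 0 := by
  have := tprod_one_add_ne_zero_of_summable (f := fun n : ℕ => -q^(n+1))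
    (fun i => by simpa [← sub_eq_add_neg] using one_sub_ne hq i)
    (by simpa using (summable_nat_add_iff 1).mpr (summable_geometric_of_lt_one (norm_nonneg _) hq))
  simpa [PP, sub_eq_add_neg] using this

noncomputable def jt (q : ℂ) (r : ℕ) : ℂ := (2*(r:ℂ)+1) * ((-1)^r * q^(r*(r+1)/2))

lemma tri_ge (r : ℕ) : r ≤ r*(r+1)/2 := by
  induction r with
  | zero => simp
  | succ n ih => rw [tri_succ]; omega

lemma jt_norm (q : ℂ) (r : ℕ) : ‖jt q r‖ = (2*(r:ℝ)+1) * ‖q‖^(r*(r+1)/2) := by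
  have : ‖(2*(r:ℂ)+1)‖ = 2*(r:ℝ)+1 := by
    have : (2*(r:ℂ)+1) = ((2*r+1 : ℕ) : ℂ) := by push_cast; ring
    rw [this, Complex.norm_natCast]; push_cast; ring
  simp [jt, this]

lemma jt_summable_norm {q : ℂ} (hq : ‖q‖ < 1) : Summable fun r => ‖jt q r‖ := by
  have h1 : Summable fun r : ℕ => (2*(r:ℝ)+1) * ‖q‖^r := by
    have a := (summable_pow_mul_geometric_of_norm_lt_one 1 (r := ‖q‖) (by simpa using hq)).mul_left 2
    have b := summable_geometric_of_lt_one (norm_nonneg q) hq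
    refine (a.add b).congr fun r => ?_
    simp; ring
  refine Summable.of_nonneg_of_le (fun r => norm_nonneg _) (fun r => ?_) h1
  rw [jt_norm]
  gcongr ?_ * ?_
  exact pow_le_pow_of_le_one (norm_nonneg q) hq.le (tri_ge r)

lemma jacobi {q : ℂ} (hq : ‖q‖ < 1) : PP q ^ 3 = ∑' r, jt q r := by
  have hQ := Q_tendsto hq
  have hP := PP_ne hq
  have hQi := hQ.inv₀ hP
  obtain ⟨C, hC⟩ := (Metric.isBounded_range_of_tendsto _ hQ).exists_norm_le
  obtain ⟨D, hD⟩ := (Metric.isBounded_range_of_tendsto _ hQi).exists_norm_le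
  have hC' : ∀ n, ‖Q q n‖ ≤ C := fun n => hC _ ⟨n, rfl⟩
  have hD' : ∀ n, ‖(Q q n)⁻¹‖ ≤ D := fun n => hD _ ⟨n, rfl⟩
  have hC0 : 0 ≤ C := (norm_nonneg _).trans (hC' 0)
  have hD0 : 0 ≤ D := (norm_nonneg _).trans (hD' 0)
  have key : Tendsto (fun n => ∑' r : ℕ, (2*(r:ℂ)+1) * ee q n r) atTop (𝓝 (∑' r, jt q r * (PP q)⁻¹)) := by
    refine tendsto_tsum_of_dominated_convergence (bound := fun r => ‖jt q r‖ * (C * (D * D)))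
      ((jt_summable_norm hq).mul_right _) (fun r => ?_) (Eventually.of_forall fun n r => ?_)
    · have t1 : Tendsto (fun n => Q q (2*n+1)) atTop (𝓝 (PP q)) :=
        hQ.comp (tendsto_atTop_mono (fun n => by simp only [id]; omega) tendsto_id)
      have t2 : Tendsto (fun n => Q q (n-r)) atTop (𝓝 (PP q)) :=
        hQ.comp (tendsto_sub_atTop_nat r)
      have t3 : Tendsto (fun n => Q q (n+1+r)) atTop (𝓝 (PP q)) :=
        hQ.comp (tendsto_atTop_mono (fun n => by simp only [id]; omega) tendsto_id)
      have t := (t1.div (t2.mul t3) (mul_ne_zero hP hP)).const_mul (jt q r)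
      rw [show PP q / (PP q * PP q) = (PP q)⁻¹ by field_simp] at t
      refine t.congr' ?_
      filter_upwards [eventually_ge_atTop r] with n hn
      simp [ee, hn, jt]; ring
    · by_cases h : r ≤ n
      · rw [show (2*(r:ℂ)+1) * ee q n r = jt q r * (Q q (2*n+1) * ((Q q (n-r))⁻¹ * (Q q (n+1+r))⁻¹)) by
          simp [ee, h, jt, div_eq_mul_inv]; ring]
        rw [norm_mul, norm_mul, norm_mul]
        gcongr
        · exact hC' _
        · exact hD' _
        · exact hD' _
      · simp only [ee, h, if_false, mul_zero, norm_zero]; positivity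
  have e1 : (fun n => ∑' r : ℕ, (2*(r:ℂ)+1) * ee q n r) = fun n => Q q n ^ 2 := by
    ext n
    rw [← finJac hq n]
    refine tsum_eq_sum fun r hr => ?_
    have : ¬ r ≤ n := by simpa using hr
    simp [ee, this]
  rw [e1, tsum_mul_right] at key
  have := tendsto_nhds_unique (hQ.pow 2) key
  field_simp at this
  linear_combination this

lemma jt_shift (q : ℂ) (m : ℕ) : jt q (3*m+1) = -3 * q * jt (q^9) m := by
  have : (3*m+1)*(3*m+1+1)/2 = 1 + 9*(m*(m+1)/2) := by
    have h := Nat.even_mul_succ_self m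
    obtain ⟨k, hk⟩ := h
    rw [show (3*m+1)*(3*m+1+1) = 9*(m*(m+1)) + 2 by ring, hk]
    omega
  simp only [jt, this, pow_add, pow_mul]
  push_cast
  have h3 : ((-1:ℂ)^3) = -1 := by norm_num
  rw [h3]
  ring

lemma tri_mod (r : ℕ) (h : r % 3 ≠ 1) : 3 ∣ r*(r+1)/2 := by
  have h2 : 3 ∣ r * (r+1) := by
    rcases (by omega : r % 3 = 0 ∨ r % 3 = 2) with h | h
    · exact Dvd.dvd.mul_right (by omega) _
    · exact Dvd.dvd.mul_left (by omega) _
  obtain ⟨k, hk⟩ := Nat.even_mul_succ_self r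
  rw [hk] at h2 ⊢
  omega

lemma dissect {q ζ : ℂ} (hq : ‖q‖ < 1) (hζ : ζ^3 = 1) :
    PP (ζ*q)^3 = PP q ^3 - 3*(ζ-1)*q*PP (q^9)^3 := by
  have hz : ‖ζ‖ = 1 := by
    have : ‖ζ‖^3 = 1 := by rw [← norm_pow, hζ, norm_one]
    exact (pow_eq_one_iff_of_nonneg (norm_nonneg _) (by norm_num)).mp this
  have hq1 : ‖ζ*q‖ < 1 := by rw [norm_mul, hz, one_mul]; exact hq
  have hq9 : ‖q^9‖ < 1 := by rw [norm_pow]; exact pow_lt_one₀ (norm_nonneg q) hq (by norm_num)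
  rw [jacobi hq, jacobi hq1, jacobi hq9]
  have h1 : ∑' r, jt (ζ*q) r - ∑' r, jt q r = ∑' r, (jt (ζ*q) r - jt q r) :=
    ((jt_summable_norm hq1).of_norm.tsum_sub (jt_summable_norm hq).of_norm).symm
  have h2 : ∑' m : ℕ, (jt (ζ*q) (3*m+1) - jt q (3*m+1)) = ∑' r, (jt (ζ*q) r - jt q r) := by
    refine Function.Injective.tsum_eq (g := fun m : ℕ => 3*m+1) (f := fun r => jt (ζ*q) r - jt q r) (fun a b h => by simpa using h) ?_
    intro r hr
    by_contra hn
    apply hr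
    have : r % 3 ≠ 1 := fun h => hn ⟨r/3, by simp only; omega⟩
    obtain ⟨k, hk⟩ := tri_mod r this
    simp [jt, hk, mul_pow, pow_mul, hζ]
  have h9 : (ζ*q)^9 = q^9 := by
    rw [mul_pow, show ζ^9 = (ζ^3)^3 by ring, hζ]; ring
  have h3 : ∑' m : ℕ, (jt (ζ*q) (3*m+1) - jt q (3*m+1)) = -3*(ζ-1)*q*∑' m, jt (q^9) m := by
    rw [← tsum_mul_left]
    refine tsum_congr fun m => ?_
    rw [jt_shift, jt_shift, h9]; ring
  linear_combination h1 - h2 + h3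

lemma prod3 {q ζ : ℂ} (hq : ‖q‖ < 1) (hζ : 1 + ζ + ζ^2 = 0) :
    PP q * PP (ζ*q) * PP (ζ^2*q) * PP (q^9) = PP (q^3)^4 := by
  have hζ3 : ζ^3 = 1 := by linear_combination (ζ-1)*hζ
  have hz : ‖ζ‖ = 1 := by
    have : ‖ζ‖^3 = 1 := by rw [← norm_pow, hζ3, norm_one]
    exact (pow_eq_one_iff_of_nonneg (norm_nonneg _) (by norm_num)).mp this
  have hq1 : ‖ζ*q‖ < 1 := by rw [norm_mul, hz, one_mul]; exact hq
  have hq2 : ‖ζ^2*q‖ < 1 := by rw [norm_mul, norm_pow, hz]; simpa using hq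
  have hq3 : ‖q^3‖ < 1 := by rw [norm_pow]; exact pow_lt_one₀ (norm_nonneg q) hq (by norm_num)
  have hq9 : ‖q^9‖ < 1 := by rw [norm_pow]; exact pow_lt_one₀ (norm_nonneg q) hq (by norm_num)
  have inj : Function.Injective (fun m : ℕ => 3*m+2) := fun a b h => by simpa using h
  have ext : ∀ x : ℂ, ‖x^3‖ < 1 → Multipliable (fun n : ℕ => if n % 3 = 2 then 1 - x^(n+1) else 1) ∧
      ∏' n : ℕ, (if n % 3 = 2 then 1 - x^(n+1) else 1) = PP (x^3) := by
    intro x hx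
    have hs : Function.mulSupport (fun n : ℕ => if n % 3 = 2 then 1 - x^(n+1) else 1) ⊆ Set.range (fun m : ℕ => 3*m+2) := by
      intro n hn
      by_contra hn'
      apply hn
      have : n % 3 ≠ 2 := fun h => hn' ⟨n/3, by simp only; omega⟩
      simp [this]
    have hc : (fun n : ℕ => if n % 3 = 2 then 1 - x^(n+1) else 1) ∘ (fun m : ℕ => 3*m+2) = fun m => 1 - (x^3)^(m+1) := by
      ext m
      have : (3*m+2) % 3 = 2 := by omega
      simp only [Function.comp, this, if_true, ← pow_mul]
      ring_nf
    constructor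
    · rw [← Function.Injective.multipliable_iff inj (fun n hn => by
        by_contra h; exact hn (hs h)), hc]
      exact ModularForm.multipliable_one_sub_pow hx
    · rw [← Function.Injective.tprod_eq inj hs, PP]
      exact tprod_congr fun m => congrFun hc m
  obtain ⟨ma, ea⟩ := ext q hq3
  obtain ⟨mb, eb⟩ := ext (q^3) (by rw [← pow_mul]; exact hq9)
  have m0 := ModularForm.multipliable_one_sub_pow hq
  have m1 := ModularForm.multipliable_one_sub_pow hq1
  have m2 := ModularForm.multipliable_one_sub_pow hq2
  have m3 := ModularForm.multipliable_one_sub_pow hq3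
  rw [← pow_mul] at eb
  norm_num at eb
  rw [← eb, show PP (q^3)^4 = PP (q^3) * (PP (q^3) * (PP (q^3) * PP (q^3))) by ring]
  nth_rewrite 2 3 4 [← ea]
  simp only [PP]
  rw [← m0.tprod_mul m1, ← (m0.mul m1).tprod_mul m2, ← ((m0.mul m1).mul m2).tprod_mul (by simpa using mb),
    ← ma.tprod_mul ma, ← ma.tprod_mul (ma.mul ma), ← m3.tprod_mul (ma.mul (ma.mul ma))]
  refine tprod_congr fun n => ?_
  by_cases h : n % 3 = 2
  · obtain ⟨k, hk⟩ : 3 ∣ n+1 := by omega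
    have e1 : (ζ*q)^(n+1) = q^(n+1) := by rw [mul_pow, hk, pow_mul ζ, hζ3]; simp
    have e2 : (ζ^2*q)^(n+1) = q^(n+1) := by rw [mul_pow, hk, ← pow_mul ζ, mul_left_comm, pow_mul ζ, hζ3]; simp
    simp only [h, if_true, e1, e2]
    ring
  · simp only [h, if_false, mul_one]
    set y := q^(n+1) with hy
    have e3 : (q^3)^(n+1) = y^3 := by rw [hy, ← pow_mul, ← pow_mul, mul_comm]
    rw [mul_pow, mul_pow, e3, ← hy]
    have hw : (ζ^(n+1) = ζ ∧ (ζ^2)^(n+1) = ζ^2) ∨ (ζ^(n+1) = ζ^2 ∧ (ζ^2)^(n+1) = ζ) := by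
      rcases (by omega : n % 3 = 0 ∨ n % 3 = 1) with h | h
      · left
        have : n + 1 = 3*(n/3) + 1 := by omega
        have e : ζ^(n+1) = ζ := by rw [this, pow_add, pow_mul, hζ3]; simp
        exact ⟨e, by rw [← pow_mul, mul_comm, pow_mul, e]⟩
      · right
        have : n + 1 = 3*(n/3) + 2 := by omega
        have e : ζ^(n+1) = ζ^2 := by rw [this, pow_add, pow_mul, hζ3]; simp
        exact ⟨e, by rw [← pow_mul, mul_comm, pow_mul, e]; linear_combination ζ*hζ3⟩
    rcases hw with ⟨a, b⟩ | ⟨a, b⟩ <;> rw [a, b]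
    · linear_combination (-y + y^2*ζ) * hζ + (-y^3) * hζ3
    · linear_combination (-y + y^2*ζ) * hζ + (-y^3) * hζ3

lemma level9 {q : ℂ} (hq : ‖q‖ < 1) :
    PP q ^3 * (q * PP (q^9)^3) * ((PP q^3)^2 + 9 * PP q^3 * (q*PP (q^9)^3) + 27 * (q*PP (q^9)^3)^2)
      = q * PP (q^3)^12 := by
  obtain ⟨ζ, hζ⟩ : ∃ ζ : ℂ, 1 + ζ + ζ^2 = 0 := by
    refine ⟨(-1 + Complex.I * (Real.sqrt 3 : ℂ))/2, ?_⟩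
    have : (Real.sqrt 3 : ℂ)^2 = 3 := by
      rw [← Complex.ofReal_pow, Real.sq_sqrt (by norm_num)]; norm_num
    linear_combination (Complex.I^2/4) * this + 3/4 * Complex.I_sq
  have hζ3 : ζ^3 = 1 := by linear_combination (ζ-1)*hζ
  have p := prod3 hq hζ
  have d1 := dissect hq hζ3
  have d2 := dissect (ζ := ζ^2) hq (by rw [← pow_mul, mul_comm, pow_mul, hζ3]; simp)
  have p3 : PP q^3 * PP (ζ*q)^3 * PP (ζ^2*q)^3 * PP (q^9)^3 = PP (q^3)^12 := by
    rw [← mul_pow, ← mul_pow, ← mul_pow, p, ← pow_mul]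
  rw [d1, d2] at p3
  rw [← p3]
  have hz2 : ζ^2 = -1 - ζ := by linear_combination hζ
  rw [hz2]
  generalize PP q ^ 3 = X
  generalize PP (q^9)^3 = Y
  linear_combination (9*q^3*X*Y^3) * hζ

lemma eta_eq (τ : ℂ) : eta τ = ModularForm.eta τ := by
  simp only [eta, ModularForm.eta, ModularForm.eta_q_eq_cexp]
  congr 1
  simp only [Function.Periodic.qParam]
  congr 1
  push_cast
  ring

lemma eta_pow (τ : ℂ) : eta τ ^ 12 =
    Complex.exp (Real.pi * Complex.I * τ) * PP (Complex.exp (2 * Real.pi * Complex.I * τ))^12 := by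
  rw [eta, mul_pow, ← Complex.exp_nat_mul]
  congr 2
  · push_cast; ring
  · rw [PP]
    refine tprod_congr fun n => ?_
    rw [← Complex.exp_nat_mul]
    push_cast
    ring_nf

lemma csqrt_pow {z : ℂ} (hz : z ≠ 0) : Complex.sqrt z ^ 12 = z ^ 6 := by
  have : Complex.sqrt z ^ 2 = z := by
    rw [Complex.sqrt, ← Complex.cpow_nat_mul]; simp
  rw [show Complex.sqrt z ^ 12 = (Complex.sqrt z ^ 2)^6 by ring, this]

lemma s3 : (Real.sqrt 3 : ℂ)^2 = 3 := by
  rw [← Complex.ofReal_pow, Real.sq_sqrt (by norm_num)]; norm_num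

lemma fricke : eta (Complex.I * (Real.sqrt 3 : ℂ) / 3) ^ 12 = 27 * eta (Complex.I * (Real.sqrt 3 : ℂ)) ^ 12 := by
  have hz : (Complex.I * (Real.sqrt 3 : ℂ) / 3) ∈ UpperHalfPlane.upperHalfPlaneSet := by
    have : (Complex.I * (Real.sqrt 3 : ℂ) / 3) = ((Real.sqrt 3 / 3 : ℝ) : ℂ) * Complex.I := by push_cast; ring
    rw [this]
    simp [UpperHalfPlane.upperHalfPlaneSet]
  have h := ModularForm.eta_comp_eq_csqrt_I_inv hz
  have h3 : (Real.sqrt 3 : ℂ) ≠ 0 := by simp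
  have e : -1 / (Complex.I * (Real.sqrt 3 : ℂ) / 3) = Complex.I * (Real.sqrt 3 : ℂ) := by
    field_simp
    linear_combination -(Complex.I^2) * s3 - 3 * Complex.I_sq
  simp only [Function.comp, e, Pi.smul_apply, Pi.mul_apply, smul_eq_mul] at h
  rw [eta_eq, eta_eq, h, mul_pow, mul_pow, inv_pow, csqrt_pow Complex.I_ne_zero,
    csqrt_pow (by simp)]
  have e6 : (Complex.I * (Real.sqrt 3 : ℂ) / 3)^6 = -1/27 := by
    rw [show (Complex.I * (Real.sqrt 3 : ℂ) / 3)^6 = (Complex.I^2)^3 * ((Real.sqrt 3 : ℂ)^2)^3 / 729 by ring, s3, Complex.I_sq]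
    norm_num
  rw [e6, show Complex.I^6 = (Complex.I^2)^3 by ring, Complex.I_sq]
  norm_num
  ring

lemma PP_real (x : ℝ) (hx : ‖(x:ℂ)‖ < 1) : ∃ y : ℝ, PP (x:ℂ) = y := by
  have h : (starRingEnd ℂ) (PP x) = PP x := by
    have t := Q_tendsto hx
    have t2 := (Complex.continuous_conj.tendsto _).comp t
    refine tendsto_nhds_unique t2 (t.congr fun n => ?_)
    simp [Q, map_prod]
  obtain ⟨y, hy⟩ := Complex.conj_eq_iff_real.mp h
  exact ⟨y, hy⟩

theorem stmt7 :
    27 + (eta (Complex.I * (Real.sqrt 3 : ℂ) / 9) /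
          eta (Complex.I * (Real.sqrt 3 : ℂ) / 3)) ^ 12 =
      6 - 6 * (((2:ℝ) ^ ((1:ℝ)/3) : ℝ) : ℂ) + 18 * (((2:ℝ) ^ ((2:ℝ)/3) : ℝ) : ℂ) := by
  set s : ℝ := (2:ℝ) ^ ((1:ℝ)/3) with hs
  have hs3 : s^3 = 2 := by
    rw [hs, ← Real.rpow_natCast, ← Real.rpow_mul (by norm_num)]; norm_num
  have hs2 : (2:ℝ) ^ ((2:ℝ)/3) = s^2 := by
    rw [hs, ← Real.rpow_natCast, ← Real.rpow_mul (by norm_num)]; norm_num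
  rw [hs2]
  set x : ℝ := Real.exp (-(2 * Real.pi * (Real.sqrt 3 / 9))) with hx
  have hx0 : 0 < x := Real.exp_pos _
  have hx1 : x < 1 := by
    rw [hx, Real.exp_lt_one_iff]
    have := Real.pi_pos
    have : 0 < Real.sqrt 3 := by simp
    simp only [neg_lt_zero]
    positivity
  have hq : ‖(x:ℂ)‖ < 1 := by simpa [abs_of_pos hx0] using hx1
  have hq9 : ‖((x^9:ℝ):ℂ)‖ < 1 := by
    rw [Complex.norm_real, Real.norm_of_nonneg (by positivity)]
    exact pow_lt_one₀ hx0.le hx1 (by norm_num)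
  have hq3 : ‖(x:ℂ)^3‖ < 1 := by
    rw [norm_pow]; exact pow_lt_one₀ (norm_nonneg _) hq (by norm_num)
  set w : ℂ := Complex.exp (Real.pi * Complex.I * (Complex.I * (Real.sqrt 3 : ℂ) / 9)) with hw
  have hw0 : w ≠ 0 := Complex.exp_ne_zero _
  have hwx : (x:ℂ) = w^2 := by
    rw [hw, ← Complex.exp_nat_mul, hx, Complex.ofReal_exp]
    congr 1
    push_cast
    linear_combination (-2 * Real.pi * (Real.sqrt 3 : ℂ) / 9) * Complex.I_sq
  have E1 : eta (Complex.I * (Real.sqrt 3 : ℂ) / 9) ^ 12 = w * PP x ^ 12 := by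
    rw [eta_pow, hwx, hw, ← Complex.exp_nat_mul]
    push_cast
    ring_nf
  have E3 : eta (Complex.I * (Real.sqrt 3 : ℂ) / 3) ^ 12 = w^3 * PP ((x:ℂ)^3) ^ 12 := by
    rw [eta_pow, hwx, hw, ← pow_mul, ← Complex.exp_nat_mul, ← Complex.exp_nat_mul]
    push_cast
    ring_nf
  have E9 : eta (Complex.I * (Real.sqrt 3 : ℂ)) ^ 12 = w^9 * PP ((x:ℂ)^9) ^ 12 := by
    rw [eta_pow, hwx, hw, ← pow_mul, ← Complex.exp_nat_mul, ← Complex.exp_nat_mul]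
    push_cast
    ring_nf
  have F := fricke
  rw [E3, E9] at F
  have L := level9 hq
  have N1 := PP_ne hq
  have N3 := PP_ne hq3
  have N9 := PP_ne hq9
  obtain ⟨a, ha⟩ := PP_real x hq
  obtain ⟨b, hb⟩ := PP_real (x^9) hq9
  rw [div_pow, E1, E3]
  push_cast at hb N9
  rw [hb] at N9 F L
  rw [ha] at N1 L ⊢
  generalize PP ((x:ℂ)^3) = c at *
  have hb0 : b ≠ 0 := by exact_mod_cast N9
  have ha0 : a ≠ 0 := by exact_mod_cast N1
  have F' : c^12 = 27 * (x:ℂ)^3 * b^12 := by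
    apply mul_left_cancel₀ (pow_ne_zero 3 hw0)
    rw [F, hwx]; ring
  set Y : ℝ := x * b^3 with hY
  have hY0 : Y ≠ 0 := mul_ne_zero hx0.ne' (pow_ne_zero _ hb0)
  set X : ℝ := a^3 with hX
  have R : X * (X^2 + 9*X*Y + 27*Y^2) = 27 * Y^3 := by
    apply mul_left_cancel₀ hY0
    have : ((Y * (X * (X^2 + 9*X*Y + 27*Y^2)) : ℝ) : ℂ) = ((Y * (27*Y^3) : ℝ) : ℂ) := by
      rw [F'] at L
      push_cast [hX, hY]
      linear_combination L
    exact_mod_cast this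
  have R2 : (X + 3*Y)^3 = (3*s*Y)^3 := by
    linear_combination R - 27*Y^3*hs3
  have R3 : X + 3*Y = 3*s*Y := by
    have : Odd 3 := by decide
    exact this.strictMono_pow.injective R2
  have R4 : X = 3*(s-1)*Y := by linear_combination R3
  have e : w * (a:ℂ)^12 / (w^3 * c^12) = ((X^4/(27*Y^4) : ℝ) : ℂ) := by
    have hx0' : (x:ℂ) ≠ 0 := by exact_mod_cast hx0.ne'
    rw [F', show w^3 = w * x by rw [hwx]; ring]
    push_cast [hX, hY]
    field_simp
  rw [e]
  have e2 : X^4/(27*Y^4) = 3*(s-1)^4 := by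
    rw [R4]; field_simp; ring
  rw [e2]
  have fin : 27 + 3*(s-1)^4 = 6 - 6*s + 18*s^2 := by
    linear_combination (3*s - 12) * hs3
  exact_mod_cast fin
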